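/- arXiv:2605.27797 — 3 statements merged into one kernel-verified Lean document; each statement's English description precedes it below -/
import Mathlib

section
/- Let R be a commutative local ring with maximal ideal 𝔪 and residue field k = R/𝔪, let J be an ideal of R[s], and let b ∈ J be monic with degree minimal among the degrees of monic elements of J. Then for every z ∈ k, the following are equivalent: (i) z is a root of the residue image in k[s] of every element of J; (ii) z is a root of the residue image of b in k[s]. In other words, the common zero set of the residue images of the elements of J equals the zero set of the residue image of b. -/
open Polynomial IsLocalRing in
/-- A polynomial of degree less than `d` with residue image zero lies in `𝔪 • R[X]_{<d}`. -/
theorem mem_maximalIdeal_smul_degreeLT {R : Type*} [CommRing R] [IsLocalRing R] {d : ℕ}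
    {p : R[X]} (hd : p ∈ degreeLT R d) (hp : p.map (residue R) = 0) :
    p ∈ maximalIdeal R • degreeLT R d := by
  rw [mem_degreeLT] at hd
  rw [p.as_sum_support]
  refine Submodule.sum_mem _ fun i hi => ?_
  rw [← mul_one (p.coeff i), ← smul_eq_mul, ← smul_monomial]
  refine Submodule.smul_mem_smul ?_ ?_
  · rw [← residue_eq_zero_iff, ← coeff_map, hp, coeff_zero]
  · rw [mem_degreeLT]
    exact (degree_monomial_le i 1).trans_lt ((le_degree_of_mem_supp i hi).trans_lt hd)

open Polynomial IsLocalRing in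
/-- If an ideal `J` of `R[X]` contains a monic polynomial, and its image in `k[X]` is generated
by a nonzero polynomial `g` of degree less than that of the monic polynomial, then `J` contains a
monic polynomial of the same degree as `g`. -/
theorem exists_monic_mem_degree_eq_of_map_residue_eq_span {R : Type*} [CommRing R] [IsLocalRing R]
    {J : Ideal R[X]} {b : R[X]} (hbJ : b ∈ J) (hb : b.Monic) {g : (ResidueField R)[X]}
    (hg : g ≠ 0) (hJ : J.map (mapRingHom (residue R)) = Ideal.span {g})
    (hdeg : g.natDegree < b.natDegree) :
    ∃ f ∈ J, f.Monic ∧ f.natDegree = g.natDegree := by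
  have hsurj : Function.Surjective (mapRingHom (residue R)) :=
    map_surjective _ residue_surjective
  have key : degreeLT R b.natDegree ≤ J.restrictScalars R ⊔ degreeLT R g.natDegree := by
    refine Submodule.le_of_le_smul_of_le_jacobson_bot (I := maximalIdeal R) ?_
      (IsLocalRing.jacobson_eq_maximalIdeal ⊥ bot_ne_top).ge ?_
    · classical
    rw [degreeLT_eq_span_X_pow]
      exact ⟨_, rfl⟩
    intro p hp
    have hgq : g * (p.map (residue R) / g) ∈ J.map (mapRingHom (residue R)) := by
      rw [hJ]
      exact Ideal.mul_mem_right _ _ (Ideal.mem_span_singleton_self g)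
    obtain ⟨f, hfJ, hf⟩ := (Ideal.mem_map_iff_of_surjective _ hsurj).1 hgq
    obtain ⟨r, hr, hrdeg⟩ := exists_degree_eq_of_mem_lifts (f := residue R)
      (p := p.map (residue R) % g) ((mem_lifts _).2 (hsurj _))
    have hr_lt : r ∈ degreeLT R g.natDegree := by
      rw [mem_degreeLT, hrdeg, ← degree_eq_natDegree hg]
      exact EuclideanDomain.mod_lt _ hg
    have hmap : (p - f - r).map (residue R) = 0 := by
      rw [coe_mapRingHom] at hf
      rw [Polynomial.map_sub, Polynomial.map_sub, hf, hr, sub_sub, EuclideanDomain.div_add_mod,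
        sub_self]
    have hrem : (p - f - r) %ₘ b ∈ maximalIdeal R • degreeLT R b.natDegree := by
      refine mem_maximalIdeal_smul_degreeLT ?_ ?_
      · rw [mem_degreeLT, ← degree_eq_natDegree hb.ne_zero]
        exact degree_modByMonic_lt _ hb
      · rw [map_modByMonic _ hb, hmap, zero_modByMonic]
    have hsplit : p = (f + b * ((p - f - r) /ₘ b) + r) + (p - f - r) %ₘ b := by
      linear_combination -(modByMonic_add_div (p - f - r) b)
    rw [hsplit]
    exact Submodule.add_mem_sup (Submodule.add_mem_sup
      (show _ ∈ J from J.add_mem hfJ (J.mul_mem_right _ hbJ)) hr_lt) hrem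
  have hX : (X ^ g.natDegree : R[X]) ∈ degreeLT R b.natDegree := by
    rw [mem_degreeLT, degree_X_pow]
    exact_mod_cast hdeg
  obtain ⟨f, hfJ, r, hr, hfr⟩ := Submodule.mem_sup.1 (key hX)
  rw [mem_degreeLT] at hr
  have hf : f = X ^ g.natDegree - r := eq_sub_of_add_eq hfr
  refine ⟨f, hfJ, hf ▸ monic_X_pow_sub hr, ?_⟩
  rw [hf, natDegree_eq_of_degree_eq (degree_sub_eq_left_of_degree_lt (by rwa [degree_X_pow])),
    natDegree_X_pow]


/-- The common zero set in `k = R/𝔪` of the residue images of the elements of an ideal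
`J` of `R[s]` equals the zero set of the residue image of a monic element `b ∈ J` of
minimal degree among the monic elements of `J`. -/
theorem stmt_3 (R : Type*) [CommRing R] [IsLocalRing R]
    (J : Ideal (Polynomial R)) (b : Polynomial R)
    (hbJ : b ∈ J) (hb : b.Monic)
    (hmin : ∀ g ∈ J, g.Monic → b.degree ≤ g.degree) :
    ∀ z : IsLocalRing.ResidueField R,
      ((∀ f ∈ J, (Polynomial.map (IsLocalRing.residue R) f).eval z = 0) ↔
        (Polynomial.map (IsLocalRing.residue R) b).eval z = 0) := by
  intro z
  refine ⟨fun h => h b hbJ, fun hz f hf => ?_⟩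
  let φ := Polynomial.mapRingHom (IsLocalRing.residue R)
  obtain ⟨g, hg⟩ : ∃ g, J.map φ = Ideal.span {g} :=
    (IsPrincipalIdealRing.principal (J.map φ)).principal
  have hdvd : ∀ p ∈ J, g ∣ p.map (IsLocalRing.residue R) := fun p hp =>
    Ideal.mem_span_singleton.1 (hg ▸ Ideal.mem_map_of_mem φ hp)
  have hb0 : b.map (IsLocalRing.residue R) ≠ 0 := (hb.map _).ne_zero
  have hg0 : g ≠ 0 := ne_zero_of_dvd_ne_zero hb0 (hdvd b hbJ)
  have hle : b.natDegree ≤ g.natDegree := by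
    by_contra! hlt
    obtain ⟨p, hpJ, hp, hpg⟩ :=
      exists_monic_mem_degree_eq_of_map_residue_eq_span hbJ hb hg0 hg hlt
    have := Polynomial.natDegree_le_natDegree (hmin p hpJ hp)
    omega
  have hassoc : Associated g (b.map (IsLocalRing.residue R)) :=
    Polynomial.associated_of_dvd_of_natDegree_le (hdvd b hbJ) hb0
      ((hb.natDegree_map _).trans_le hle)
  exact Polynomial.eval_eq_zero_of_dvd_of_eval_eq_zero (hassoc.symm.dvd.trans (hdvd f hf)) hz
end

section
/- Let L be a field of characteristic zero, n a natural number, 𝔭 a prime ideal of L[x], R the localization of L[x] at the prime 𝔭 (a local ring), and κ(𝔭) its residue field. Let J be an ideal of R[s]. If b and b′ are monic elements of J each of whose degrees is minimal among the degrees of monic elements of J, then the coefficientwise images of b and b′ in κ(𝔭)[s] under the residue map coincide. (The specialization of an indicial polynomial at 𝔭 to κ(𝔭)[s] is uniquely determined.) -/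
open Polynomial in
/-- Over a local ring `R`, if an ideal `J` of `R[X]` contains a monic polynomial, then the degree
of every nonzero reduction of an element of `J` is the degree of a monic element of `J`. -/
theorem IsLocalRing.exists_monic_mem_degree_eq_degree_map_residue {R : Type*} [CommRing R]
    [IsLocalRing R] {J : Ideal R[X]} {b r : R[X]} (hbJ : b ∈ J) (hb : b.Monic) (hrJ : r ∈ J)
    (hr : r.map (IsLocalRing.residue R) ≠ 0) :
    ∃ g ∈ J, g.Monic ∧ g.degree = (r.map (IsLocalRing.residue R)).degree := by
  set rbar := r.map (IsLocalRing.residue R) with hrbar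
  obtain ⟨c, hc⟩ := IsLocalRing.residue_surjective (rbar.leadingCoeff⁻¹)
  have hmon : (rbar * C rbar.leadingCoeff⁻¹).Monic := monic_mul_leadingCoeff_inv hr
  obtain ⟨r₀, hr₀map, hr₀deg, hr₀⟩ := lifts_and_degree_eq_and_monic
    (f := IsLocalRing.residue R)
    ((lifts_iff_coeff_lifts _).2 fun k ↦ IsLocalRing.residue_surjective _) hmon
  rw [degree_mul_leadingCoeff_inv _ hr] at hr₀deg
  have ht : r₀ - r * C c ∈ (IsLocalRing.maximalIdeal R).map (C : R →+* R[X]) := by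
    rw [Ideal.mem_map_C_iff]
    intro k
    rw [← IsLocalRing.residue_eq_zero_iff, ← coeff_map, Polynomial.map_sub, hr₀map,
      Polynomial.map_mul, map_C, hc, sub_self, coeff_zero]
  have : Module.Finite R (R[X] ⧸ Ideal.span {b}) := hb.finite_quotient
  have hle : Ideal.span {b} ≤ J := (Ideal.span_singleton_le_iff_mem J).2 hbJ
  have : Module.Finite R (R[X] ⧸ J) :=
    Module.Finite.of_surjective (Ideal.Quotient.factorₐ R hle).toLinearMap
      (Ideal.Quotient.factor_surjective hle)
  let π : R[X] →ₗ[R] R[X] ⧸ J := (Ideal.Quotient.mkₐ R J).toLinearMap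
  have hπ (p : R[X]) : π p = Ideal.Quotient.mk J p := rfl
  have htop : (⊤ : Submodule R (R[X] ⧸ J)) ≤ (degreeLT R r₀.natDegree).map π := by
    refine Submodule.le_of_le_smul_of_le_jacobson_bot Module.Finite.fg_top
      (IsLocalRing.maximalIdeal_le_jacobson ⊥) ?_
    rintro x -
    obtain ⟨p, rfl⟩ := Ideal.Quotient.mk_surjective x
    have hp : Ideal.Quotient.mk J p = π (p %ₘ r₀) +
        Ideal.Quotient.mk J ((r₀ - r * C c) * (p /ₘ r₀)) := by
      rw [hπ, ← map_add, Ideal.Quotient.mk_eq_mk_iff_sub_mem]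
      have : p - (p %ₘ r₀ + (r₀ - r * C c) * (p /ₘ r₀)) = r * (C c * (p /ₘ r₀)) := by
        linear_combination -modByMonic_add_div p r₀
      rw [this]
      exact J.mul_mem_right _ hrJ
    rw [hp]
    refine Submodule.add_mem_sup (Submodule.mem_map_of_mem ?_) ?_
    · rw [mem_degreeLT, ← degree_eq_natDegree hr₀.ne_zero]
      exact degree_modByMonic_lt p hr₀
    · rw [Ideal.smul_top_eq_map, Submodule.restrictScalars_mem, map_mul]
      refine Ideal.mul_mem_right _ _ ?_
      have := Ideal.mem_map_of_mem (Ideal.Quotient.mk J) ht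
      rwa [Ideal.map_map] at this
  obtain ⟨q, hq, hqX⟩ := htop (Submodule.mem_top (x := π (X ^ r₀.natDegree)))
  have hlt := mem_degreeLT.1 hq
  refine ⟨X ^ r₀.natDegree - q, ?_, monic_X_pow_sub hlt, ?_⟩
  · rw [← Ideal.Quotient.mk_eq_mk_iff_sub_mem]
    exact hqX.symm
  · rw [degree_sub_eq_left_of_degree_lt (by rwa [degree_X_pow]), degree_X_pow,
      ← degree_eq_natDegree hr₀.ne_zero, hr₀deg]

open Polynomial in
/-- Over a local ring `R`, two monic elements of an ideal of `R[X]` which both have minimal degree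
among the monic elements of the ideal have the same reduction to the residue field. -/
theorem IsLocalRing.map_residue_eq_of_monic_of_degree_minimal {R : Type*} [CommRing R]
    [IsLocalRing R] {J : Ideal R[X]} {b b' : R[X]} (hbJ : b ∈ J) (hb : b.Monic)
    (hbmin : ∀ g ∈ J, g.Monic → b.degree ≤ g.degree) (hb'J : b' ∈ J) (hb' : b'.Monic)
    (hb'min : ∀ g ∈ J, g.Monic → b'.degree ≤ g.degree) :
    b.map (IsLocalRing.residue R) = b'.map (IsLocalRing.residue R) := by
  by_contra hne
  have hsub : (b - b').map (IsLocalRing.residue R) ≠ 0 := by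
    rwa [Polynomial.map_sub, sub_ne_zero]
  obtain ⟨g, hgJ, hg, hdeg⟩ :=
    exists_monic_mem_degree_eq_degree_map_residue hbJ hb (J.sub_mem hbJ hb'J) hsub
  have hlt : (b - b').degree < b.degree :=
    Polynomial.degree_sub_lt_left (le_antisymm (hbmin b' hb'J hb') (hb'min b hbJ hb)) hb.ne_zero
      (hb.leadingCoeff.trans hb'.leadingCoeff.symm)
  exact absurd (hbmin g hgJ hg)
    (not_le.2 ((hdeg.trans_le Polynomial.degree_map_le).trans_lt hlt))

/-- The specialization of an indicial polynomial at a prime `𝔭` to `κ(𝔭)[s]` is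
uniquely determined: two monic elements of an ideal `J` of `R[s]`, where
`R = L[x]_𝔭`, each of minimal degree among monic elements of `J`, have equal
coefficientwise images in `κ(𝔭)[s]`. -/
theorem stmt_11 (L : Type*) [Field L] [CharZero L] (n : ℕ)
    (𝔭 : Ideal (MvPolynomial (Fin n) L)) [𝔭.IsPrime]
    (J : Ideal (Polynomial (Localization.AtPrime 𝔭)))
    (b b' : Polynomial (Localization.AtPrime 𝔭))
    (hbJ : b ∈ J) (hb : b.Monic)
    (hbmin : ∀ g ∈ J, g.Monic → b.degree ≤ g.degree)
    (hb'J : b' ∈ J) (hb' : b'.Monic)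
    (hb'min : ∀ g ∈ J, g.Monic → b'.degree ≤ g.degree) :
    Polynomial.map (IsLocalRing.residue (Localization.AtPrime 𝔭)) b =
      Polynomial.map (IsLocalRing.residue (Localization.AtPrime 𝔭)) b' := by
  exact IsLocalRing.map_residue_eq_of_monic_of_degree_minimal hbJ hb hbmin hb'J hb' hb'min
end

section
/- Let L be a field of characteristic zero, L̃ an extension field of L, n a natural number, J an ideal of L[x][s], and g ∈ L[x][s]. Let g̃ denote the image of g in L̃[x][s] under the base-change map. Then the ideal {a ∈ L̃[x] : a·g̃ ∈ J_{L̃}} of L̃[x] equals the ideal of L̃[x] generated by the image under the base-change map L[x] → L̃[x] of the ideal {a ∈ L[x] : a·g ∈ J} of L[x]. (The colon ideal by a single element, intersected with the coefficient ring, commutes with field base change.) -/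
namespace Polynomial

variable {A B : Type*} [CommRing A] [CommRing B] [Algebra A B]

/-- The map `B[X] → A[X]` applying an `A`-linear form `B → A` to each coefficient. -/
noncomputable def mapLinearForm (φ : B →ₗ[A] A) : Polynomial B →ₗ[A] Polynomial A :=
  lsum fun k => (monomial k).comp φ

theorem coeff_mapLinearForm (φ : B →ₗ[A] A) (p : Polynomial B) (k : ℕ) :
    (mapLinearForm φ p).coeff k = φ (p.coeff k) := by
  simp only [mapLinearForm, lsum_apply, LinearMap.comp_apply]
  rw [sum_def, finsetSum_coeff]
  simp +contextual [coeff_monomial]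

theorem mapLinearForm_mul_map (φ : B →ₗ[A] A) (q : Polynomial B) (p : Polynomial A) :
    mapLinearForm φ (q * p.map (algebraMap A B)) = mapLinearForm φ q * p := by
  ext k
  simp only [coeff_mapLinearForm, coeff_mul, coeff_map, map_sum]
  refine Finset.sum_congr rfl fun x _ => ?_
  rw [mul_comm, ← Algebra.smul_def, map_smul, smul_eq_mul, mul_comm]

theorem mapLinearForm_C (φ : B →ₗ[A] A) (b : B) : mapLinearForm φ (C b) = C (φ b) := by
  ext k
  rw [coeff_mapLinearForm, coeff_C, coeff_C]
  split_ifs <;> simp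

theorem mapLinearForm_mem_of_mem_map (φ : B →ₗ[A] A) {J : Ideal (Polynomial A)}
    {p : Polynomial B} (hp : p ∈ J.map (mapRingHom (algebraMap A B))) :
    mapLinearForm φ p ∈ J := by
  suffices h : ∀ q, mapLinearForm φ (q * p) ∈ J by simpa using h 1
  induction hp using Submodule.span_induction with
  | mem x hx =>
    obtain ⟨y, hy, rfl⟩ := hx
    intro q
    rw [coe_mapRingHom, mapLinearForm_mul_map]
    exact J.mul_mem_left _ hy
  | zero => simp
  | add x y _ _ hx hy =>
    intro q
    rw [mul_add, map_add]
    exact J.add_mem (hx q) (hy q)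
  | smul r x _ hx =>
    intro q
    rw [smul_eq_mul, ← mul_assoc]
    exact hx _

/-- The constants in a colon ideal by a single polynomial commute with free base change. -/
theorem C_mul_map_mem_map_iff [Module.Free A B] (J : Ideal (Polynomial A)) (g : Polynomial A)
    (b : B) :
    C b * g.map (algebraMap A B) ∈ J.map (mapRingHom (algebraMap A B)) ↔
      b ∈ Ideal.span (algebraMap A B '' {a | C a * g ∈ J}) := by
  constructor
  · intro h
    let e := Module.Free.chooseBasis A B
    rw [← e.linearCombination_repr b, Finsupp.linearCombination_apply]
    refine Ideal.sum_mem _ fun i _ => ?_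
    simp only [Algebra.smul_def]
    refine Ideal.mul_mem_right _ _ (Ideal.subset_span ⟨_, ?_, rfl⟩)
    have := mapLinearForm_mem_of_mem_map (e.coord i) h
    rwa [mapLinearForm_mul_map, mapLinearForm_C] at this
  · intro h
    induction h using Submodule.span_induction with
    | mem x hx =>
      obtain ⟨a, ha, rfl⟩ := hx
      simpa using Ideal.mem_map_of_mem (mapRingHom (algebraMap A B)) ha
    | zero => simp
    | add x y _ _ hx hy => rw [C_add, add_mul]; exact Ideal.add_mem _ hx hy
    | smul r x _ hx =>
      rw [smul_eq_mul, C_mul, mul_assoc]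
      exact Ideal.mul_mem_left _ _ hx

end Polynomial

attribute [local instance] MvPolynomial.algebraMvPolynomial in
theorem MvPolynomial.free_mvPolynomial (σ R S : Type*) [CommRing R] [CommRing S] [Algebra R S]
    [Module.Free R S] : Module.Free (MvPolynomial σ R) (MvPolynomial σ S) :=
  .of_equiv (Algebra.IsPushout.equiv R (MvPolynomial σ R) S (MvPolynomial σ S)).toLinearEquiv


/-- The colon ideal by a single element, intersected with the coefficient ring,
commutes with field base change: `(L̃⊗J : g̃) ∩ L̃[x]` is the ideal of `L̃[x]` generated
by the image of `(J : g) ∩ L[x]`. -/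
theorem stmt_16 (L Lt : Type*) [Field L] [CharZero L] [Field Lt] [Algebra L Lt] (n : ℕ)
    (J : Ideal (Polynomial (MvPolynomial (Fin n) L)))
    (g : Polynomial (MvPolynomial (Fin n) L)) :
    ∀ a : MvPolynomial (Fin n) Lt,
      Polynomial.C a * Polynomial.map (MvPolynomial.map (algebraMap L Lt)) g ∈
          J.map (Polynomial.mapRingHom (MvPolynomial.map (algebraMap L Lt))) ↔
        a ∈ Ideal.span
          ((fun a' => MvPolynomial.map (algebraMap L Lt) a') ''
            {a' : MvPolynomial (Fin n) L | Polynomial.C a' * g ∈ J}) := by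
  let := MvPolynomial.algebraMvPolynomial (σ := Fin n) (R := L) (S := Lt)
  have := MvPolynomial.free_mvPolynomial (Fin n) L Lt
  exact Polynomial.C_mul_map_mem_map_iff J g
end
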